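/- arXiv:1705.07851 — 2 statements merged into one kernel-verified Lean document; each statement's English description precedes it below -/
import Mathlib

section
/- For all nonnegative integers i and j, one has 0 = i ∫₀^∞ a₂(x)(x − r)^{i−1}(x − s)^j Ŵ(x) dx + j ∫₀^∞ a₂(x)(x − r)^i (x − s)^{j−1} Ŵ(x) dx + ∫₀^∞ a₁(x)(x − r)^i (x − s)^j Ŵ(x) dx, where a₂(x) = −x and a₁(x) = x − α − 1 + 4x(x + α + 1)/(x² + 2(α+1)x + α(α+1)) (the terms with factor i, respectively j, are omitted when i = 0, respectively j = 0). -/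
open MeasureTheory

lemma aux_poly (α : ℝ) (hα : 0 < α) (P : Polynomial ℝ) :
    IntegrableOn (fun x : ℝ => P.eval x * (x ^ α * Real.exp (-x))) (Set.Ioi 0) := by
  induction P using Polynomial.induction_on' with
  | add p q hp hq =>
    refine (hp.add hq).congr_fun (fun x _ => ?_) measurableSet_Ioi
    simp [add_mul]
  | monomial n a =>
    have h := (Real.GammaIntegral_convergent (s := α + n + 1) (by positivity)).const_mul a
    refine IntegrableOn.congr_fun h (fun x hx => ?_) measurableSet_Ioi
    have hx : (0 : ℝ) < x := hx
    simp only [Polynomial.eval_monomial]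
    rw [show α + n + 1 - 1 = α + n by ring, Real.rpow_add hx, Real.rpow_natCast]
    ring

lemma aux_Q (α : ℝ) (hα : 0 < α) (x : ℝ) (hx : 0 ≤ x) :
    α * (α + 1) / 2 ≤ x ^ 2 / 2 + (α + 1) * x + α * (α + 1) / 2 := by
  have : 0 ≤ x ^ 2 / 2 + (α + 1) * x := by positivity
  linarith

lemma aux_int (α : ℝ) (hα : 0 < α) (P : Polynomial ℝ) (n : ℕ) :
    IntegrableOn (fun x : ℝ => P.eval x * (x ^ α * Real.exp (-x)) /
      (x ^ 2 / 2 + (α + 1) * x + α * (α + 1) / 2) ^ n) (Set.Ioi 0) := by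
  have hc : 0 < α * (α + 1) / 2 := by positivity
  have h := Integrable.bdd_mul (c := ((α * (α + 1) / 2) ^ n)⁻¹)
    (f := fun x : ℝ => ((x ^ 2 / 2 + (α + 1) * x + α * (α + 1) / 2) ^ n)⁻¹)
    (aux_poly α hα P) (by
      apply Measurable.aestronglyMeasurable
      fun_prop) (by
      filter_upwards [ae_restrict_mem measurableSet_Ioi] with x hx
      have hq := aux_Q α hα x (le_of_lt hx)
      have hq0 := hc.trans_le hq
      rw [Real.norm_of_nonneg (by positivity)]
      gcongr)
  refine IntegrableOn.congr_fun h (fun x _ => ?_) measurableSet_Ioi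
  simp only [div_eq_mul_inv]
  ring

theorem stmt_8 (α : ℝ) (hα : 0 < α)
    (r s : ℝ)
    (hr : r = -(α + 1) - Real.sqrt (α + 1))
    (hs : s = -(α + 1) + Real.sqrt (α + 1))
    (W : ℝ → ℝ)
    (hW : ∀ x : ℝ, W x = x ^ α * Real.exp (-x) /
      (x ^ 2 / 2 + (α + 1) * x + α * (α + 1) / 2) ^ 2)
    (a₁ a₂ : ℝ → ℝ)
    (ha₂ : ∀ x : ℝ, a₂ x = -x)
    (ha₁ : ∀ x : ℝ, a₁ x = x - α - 1 +
      4 * x * (x + α + 1) / (x ^ 2 + 2 * (α + 1) * x + α * (α + 1))) :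
    ∀ i j : ℕ,
      0 = (i : ℝ) * (∫ x in Set.Ioi (0 : ℝ),
            a₂ x * ((x - r) ^ (i - 1) * (x - s) ^ j) * W x) +
          (j : ℝ) * (∫ x in Set.Ioi (0 : ℝ),
            a₂ x * ((x - r) ^ i * (x - s) ^ (j - 1)) * W x) +
          (∫ x in Set.Ioi (0 : ℝ),
            a₁ x * ((x - r) ^ i * (x - s) ^ j) * W x) := by
  intro i j
  have hc : 0 < α * (α + 1) / 2 := by positivity
  have hI2 : ∀ k l : ℕ, IntegrableOn (fun x => a₂ x * ((x - r) ^ k * (x - s) ^ l) * W x)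
      (Set.Ioi 0) := by
    intro k l
    refine (aux_int α hα (-Polynomial.X * ((Polynomial.X - Polynomial.C r) ^ k *
      (Polynomial.X - Polynomial.C s) ^ l)) 2).congr_fun (fun x _ => ?_) measurableSet_Ioi
    simp only [hW, ha₂, Polynomial.eval_mul, Polynomial.eval_neg, Polynomial.eval_X,
      Polynomial.eval_pow, Polynomial.eval_sub, Polynomial.eval_C]
    ring
  have hI1 : IntegrableOn (fun x => a₁ x * ((x - r) ^ i * (x - s) ^ j) * W x)
      (Set.Ioi 0) := by
    have h1 := aux_int α hα ((Polynomial.X - Polynomial.C (α + 1)) *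
      ((Polynomial.X - Polynomial.C r) ^ i * (Polynomial.X - Polynomial.C s) ^ j)) 2
    have h2 := aux_int α hα (Polynomial.C 2 * Polynomial.X * (Polynomial.X + Polynomial.C (α + 1)) *
      ((Polynomial.X - Polynomial.C r) ^ i * (Polynomial.X - Polynomial.C s) ^ j)) 3
    refine (h1.add h2).congr_fun (fun x hx => ?_) measurableSet_Ioi
    have hq0 := hc.trans_le (aux_Q α hα x (le_of_lt hx))
    simp only [hW, ha₁, Pi.add_apply, Polynomial.eval_mul, Polynomial.eval_add, Polynomial.eval_X,
      Polynomial.eval_pow, Polynomial.eval_sub, Polynomial.eval_C]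
    rw [show x ^ 2 + 2 * (α + 1) * x + α * (α + 1) =
      2 * (x ^ 2 / 2 + (α + 1) * x + α * (α + 1) / 2) by ring]
    generalize x ^ 2 / 2 + (α + 1) * x + α * (α + 1) / 2 = Q at *
    field_simp
    ring
  have hsum : IntegrableOn (fun x =>
      (i : ℝ) * (a₂ x * ((x - r) ^ (i - 1) * (x - s) ^ j) * W x) +
      (j : ℝ) * (a₂ x * ((x - r) ^ i * (x - s) ^ (j - 1)) * W x) +
      a₁ x * ((x - r) ^ i * (x - s) ^ j) * W x) (Set.Ioi 0) :=
    (((hI2 (i-1) j).const_mul _).add ((hI2 i (j-1)).const_mul _)).add hI1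
  have hder : ∀ x ∈ Set.Ioi (0:ℝ), HasDerivAt
      (fun x => a₂ x * ((x - r) ^ i * (x - s) ^ j) * W x)
      ((i : ℝ) * (a₂ x * ((x - r) ^ (i - 1) * (x - s) ^ j) * W x) +
      (j : ℝ) * (a₂ x * ((x - r) ^ i * (x - s) ^ (j - 1)) * W x) +
      a₁ x * ((x - r) ^ i * (x - s) ^ j) * W x) x := by
    intro x hx
    have hx0 : (0:ℝ) < x := hx
    have hq0 := hc.trans_le (aux_Q α hα x hx0.le)
    obtain rfl : W = _ := funext hW
    obtain rfl : a₂ = _ := funext ha₂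
    have d1 := (hasDerivAt_id x).neg
    have d2 := ((hasDerivAt_id x).sub_const r).pow i
    have d3 := ((hasDerivAt_id x).sub_const s).pow j
    have d4 := Real.hasDerivAt_rpow_const (x := x) (p := α) (Or.inl hx0.ne')
    have d5 := (hasDerivAt_id x).neg.exp
    have d6 := (((((hasDerivAt_id x).pow 2).div_const 2).add
      ((hasDerivAt_id x).const_mul (α + 1))).add_const (α * (α + 1) / 2)).pow 2
    have d := (d1.mul (d2.mul d3)).mul ((d4.mul d5).div d6 (by
      simp only [Pi.pow_apply, Pi.add_apply, id]
      positivity))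
    refine d.congr_deriv ?_
    simp only [Pi.pow_apply, Pi.add_apply, Pi.mul_apply, Pi.neg_apply, Pi.div_apply, id, ha₁]
    rw [show x ^ 2 + 2 * (α + 1) * x + α * (α + 1) =
      2 * (x ^ 2 / 2 + (α + 1) * x + α * (α + 1) / 2) by ring,
      Real.rpow_sub_one hx0.ne']
    generalize hQ : x ^ 2 / 2 + (α + 1) * x + α * (α + 1) / 2 = Q at *
    push_cast
    generalize (x - r) ^ (i - 1) = A
    generalize (x - s) ^ (j - 1) = B
    generalize (x - r) ^ i = A'
    generalize (x - s) ^ j = B'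
    generalize x ^ α = w
    generalize Real.exp (-x) = e
    field_simp
    ring
  have hcont : ContinuousWithinAt (fun x => a₂ x * ((x - r) ^ i * (x - s) ^ j) * W x)
      (Set.Ici 0) 0 := by
    obtain rfl : W = _ := funext hW
    obtain rfl : a₂ = _ := funext ha₂
    apply ContinuousAt.continuousWithinAt
    have h1 : ContinuousAt (fun x : ℝ => x ^ α) 0 :=
      Real.continuousAt_rpow_const _ _ (Or.inr hα.le)
    refine ContinuousAt.mul (by fun_prop) (ContinuousAt.div (h1.mul (by fun_prop))
      (by fun_prop) ?_)
    have := hc.ne'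
    simpa using this
  have hlim := tendsto_zero_of_hasDerivAt_of_integrableOn_Ioi hder hsum (hI2 i j)
  have key := integral_Ioi_of_hasDerivAt_of_tendsto hcont hder hsum hlim
  have h0 : a₂ 0 = 0 := by simp [ha₂]
  rw [h0] at key
  have hA : IntegrableOn (fun x =>
      (i : ℝ) * (a₂ x * ((x - r) ^ (i - 1) * (x - s) ^ j) * W x) +
      (j : ℝ) * (a₂ x * ((x - r) ^ i * (x - s) ^ (j - 1)) * W x)) (Set.Ioi 0) :=
    ((hI2 (i-1) j).const_mul _).add ((hI2 i (j-1)).const_mul _)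
  rw [integral_add hA hI1,
    integral_add ((hI2 (i-1) j).const_mul _) ((hI2 i (j-1)).const_mul _),
    integral_const_mul, integral_const_mul] at key
  rw [key]
  simp
end

section
/- The initial adjusted moment μ̃_{2,1} satisfies μ̃_{2,1} = ∫₀^∞ (x − r)² (x − s) Ŵ(x) dx = 4 e^{−s} (−s)^α Γ(1 + α) · ∫_{−s}^∞ t^{−α−1} e^{−t} dt, i.e. μ̃_{2,1} = 4 e^{−s} (−s)^α Γ(1+α) Γ(−α, −s), where Γ(x, a) = ∫_a^∞ t^{x−1} e^{−t} dt denotes the upper incomplete Gamma function (a > 0). -/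
open MeasureTheory

lemma aux_main (α : ℝ) (hα : 0 < α) (a : ℝ) (ha : 0 < a) :
    ∫ x in Set.Ioi (0 : ℝ), x ^ α * Real.exp (-x) / (x + a)
      = Real.exp a * a ^ α * Real.Gamma (1 + α) *
          ∫ t in Set.Ioi a, t ^ (-α - 1) * Real.exp (-t) := by
  have h1 : ∀ x ∈ Set.Ioi (0 : ℝ), x ^ α * Real.exp (-x) / (x + a)
      = Real.exp a / a * ∫ t in Set.Ioi a, x ^ α * Real.exp (-((x + a) / a) * t) := by
    intro x hx
    have hx : 0 < x := hx
    have hxa : 0 < x + a := by linarith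
    rw [integral_const_mul, integral_exp_mul_Ioi (by have := div_pos hxa ha; linarith)]
    have e : -((x + a) / a) * a = -x + -a := by field_simp; ring
    rw [e, Real.exp_add, Real.exp_neg a]
    have := Real.exp_pos a
    field_simp
  have hint : Integrable (Function.uncurry fun x t : ℝ => x ^ α * Real.exp (-((x + a) / a) * t))
      ((volume.restrict (Set.Ioi 0)).prod (volume.restrict (Set.Ioi a))) := by
    have hA : Integrable (fun x : ℝ => Real.exp (-x) * x ^ α) (volume.restrict (Set.Ioi 0)) := by
      have := Real.GammaIntegral_convergent (s := α + 1) (by linarith)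
      simpa [IntegrableOn] using this
    have hB : Integrable (fun t : ℝ => Real.exp (-t)) (volume.restrict (Set.Ioi a)) :=
      integrableOn_exp_neg_Ioi a
    refine (hA.mul_prod hB).mono' ?_ ?_
    · apply Measurable.aestronglyMeasurable
      unfold Function.uncurry
      fun_prop
    · rw [Measure.prod_restrict]
      refine (ae_restrict_iff' (measurableSet_Ioi.prod measurableSet_Ioi)).2 (ae_of_all _ ?_)
      rintro ⟨x, t⟩ ⟨hx, ht⟩
      have hx : 0 < x := hx
      have ht : a < t := ht
      simp only [Function.uncurry]
      rw [Real.norm_of_nonneg (by positivity), mul_comm (Real.exp (-x)), mul_assoc,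
        ← Real.exp_add]
      gcongr
      have e : -((x + a) / a) * t = -(x * (t / a)) + -t := by field_simp; ring
      have : 1 ≤ t / a := by rw [le_div_iff₀ ha]; linarith
      rw [e]
      nlinarith
  have h2 : ∀ t ∈ Set.Ioi a, ∫ x in Set.Ioi (0 : ℝ), x ^ α * Real.exp (-((x + a) / a) * t)
      = a ^ (α + 1) * Real.Gamma (1 + α) * (t ^ (-α - 1) * Real.exp (-t)) := by
    intro t ht
    have ht : a < t := ht
    have ht0 : 0 < t := ha.trans ht
    have := Real.integral_rpow_mul_exp_neg_mul_Ioi (a := α + 1) (r := t / a)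
      (by linarith) (by positivity)
    rw [add_sub_cancel_right] at this
    have e : ∀ x : ℝ, x ^ α * Real.exp (-((x + a) / a) * t)
        = x ^ α * Real.exp (-(t / a * x)) * Real.exp (-t) := by
      intro x
      rw [mul_assoc, ← Real.exp_add]
      congr 2
      field_simp
      ring
    simp_rw [e]
    rw [integral_mul_const, this, one_div_div, Real.div_rpow ha.le ht0.le,
      show -α - 1 = -(α + 1) by ring, Real.rpow_neg ht0.le, add_comm 1 α]
    ring
  rw [setIntegral_congr_fun measurableSet_Ioi h1, integral_const_mul,
    integral_integral_swap hint, setIntegral_congr_fun measurableSet_Ioi h2,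
    integral_const_mul, Real.rpow_add_one ha.ne']
  field_simp

theorem stmt_13 (α : ℝ) (hα : 0 < α)
    (r s : ℝ)
    (hr : r = -(α + 1) - Real.sqrt (α + 1))
    (hs : s = -(α + 1) + Real.sqrt (α + 1))
    (W : ℝ → ℝ)
    (hW : ∀ x : ℝ, W x = x ^ α * Real.exp (-x) /
      (x ^ 2 / 2 + (α + 1) * x + α * (α + 1) / 2) ^ 2) :
    ∫ x in Set.Ioi (0 : ℝ), (x - r) ^ 2 * (x - s) * W x
      = 4 * Real.exp (-s) * (-s) ^ α * Real.Gamma (1 + α) *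
          ∫ t in Set.Ioi (-s), t ^ (-α - 1) * Real.exp (-t) := by
  have hq : Real.sqrt (α + 1) ^ 2 = α + 1 := Real.sq_sqrt (by linarith)
  have hq0 : 0 ≤ Real.sqrt (α + 1) := Real.sqrt_nonneg _
  have hs0 : 0 < -s := by rw [hs]; nlinarith
  have hr0 : 0 < -r := by rw [hr]; linarith
  have key : ∀ x ∈ Set.Ioi (0 : ℝ), (x - r) ^ 2 * (x - s) * W x
      = 4 * (x ^ α * Real.exp (-x) / (x + -s)) := by
    intro x hx
    have hx : 0 < x := hx
    have e : x ^ 2 / 2 + (α + 1) * x + α * (α + 1) / 2 = (x - r) * (x - s) / 2 := by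
      rw [hr, hs]; linear_combination (1 / 2) * hq
    have h1 : x - r ≠ 0 := by linarith
    have h2 : x - s ≠ 0 := by linarith
    rw [hW, e, ← sub_eq_add_neg]
    field_simp
    try ring
  rw [setIntegral_congr_fun measurableSet_Ioi key, integral_const_mul, aux_main α hα (-s) hs0]
  ring
end
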